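/- Let (A,·) be a unital algebra over a field F of characteristic ≠ 2 belonging to the variety 𝒱, endowed with an involution x ↦ x̄ (an F-linear map satisfying \overline{\bar{x}} = x and \overline{x·y} = ȳ·x̄ for all x, y). Define a triple product on A by xyz := x·(ȳ·z) − ȳ·(x·z) + (ȳ·x)·z. Then (A, xyz) is a generalized Jordan triple system; moreover, taking e = 1 (the unit of A), one has eee = e, eex = x = xee for all x ∈ A, and exe = x̄ for all x ∈ A. -/

import Mathlib

/-- `D_{x,y} = L_{[x,y]} - [L_x, L_y]` for the (nonassociative) bilinear
multiplication `mul` on `A`. -/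
def Dop {F A : Type*} [Field F] [AddCommGroup A] [Module F A]
    (mul : A →ₗ[F] A →ₗ[F] A) (x y : A) : A →ₗ[F] A :=
  mul (mul x y - mul y x) - (mul x ∘ₗ mul y - mul y ∘ₗ mul x)

/-- The triple product `xyz := x·(ȳ·z) − ȳ·(x·z) + (ȳ·x)·z` attached to an
algebra with involution `inv`. -/
def trip {F A : Type*} [Field F] [AddCommGroup A] [Module F A]
    (mul : A →ₗ[F] A →ₗ[F] A) (inv : A →ₗ[F] A) (x y z : A) : A :=
  mul x (mul (inv y) z) - mul (inv y) (mul x z) + mul (mul (inv y) x) z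

section Dop

variable {F A : Type*} [Field F] [AddCommGroup A] [Module F A] {mul : A →ₗ[F] A →ₗ[F] A}

theorem Dop_apply (x y z : A) :
    Dop mul x y z = mul (mul x y) z - mul (mul y x) z - (mul x (mul y z) - mul y (mul x z)) := by
  simp [Dop]

theorem Dop_swap (x y : A) : Dop mul x y = -Dop mul y x := by
  ext z
  simp only [Dop_apply, LinearMap.neg_apply]
  abel

theorem Dop_add_left (x y z : A) : Dop mul (x + y) z = Dop mul x z + Dop mul y z := by
  ext t
  simp only [Dop_apply, LinearMap.add_apply, map_add]
  abel

theorem Dop_add_right (x y z : A) : Dop mul x (y + z) = Dop mul x y + Dop mul x z := by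
  ext t
  simp only [Dop_apply, LinearMap.add_apply, map_add]
  abel

theorem Dop_sub_left (x y z : A) : Dop mul (x - y) z = Dop mul x z - Dop mul y z := by
  ext t
  simp only [Dop_apply, LinearMap.sub_apply, map_sub]
  abel

theorem Dop_sub_right (x y z : A) : Dop mul x (y - z) = Dop mul x y - Dop mul x z := by
  ext t
  simp only [Dop_apply, LinearMap.sub_apply, map_sub]
  abel

/-- A derivation of `mul` acts on the operators `Dop mul a b` by the Leibniz rule. -/
theorem derivation_Dop {E : A →ₗ[F] A} (hE : ∀ a b, E (mul a b) = mul (E a) b + mul a (E b))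
    (a b t : A) :
    E (Dop mul a b t) = Dop mul (E a) b t + Dop mul a (E b) t + Dop mul a b (E t) := by
  simp only [Dop_apply, map_sub, map_add, hE, LinearMap.add_apply]
  abel

/-- The linearized flexible identity. -/
theorem flexible_linearized (flex : ∀ x y : A, mul (mul x y) x = mul x (mul y x)) (x y z : A) :
    mul (mul x y) z - mul x (mul y z) = mul z (mul y x) - mul (mul z y) x := by
  have h := flex (x + z) y
  simp only [map_add, LinearMap.add_apply, flex] at h
  linear_combination (norm := abel) h

theorem Dop_self_sq (flex : ∀ x y : A, mul (mul x y) x = mul x (mul y x))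
    (jordan : ∀ x y : A, mul (mul x y) (mul x x) = mul x (mul y (mul x x))) (x : A) :
    Dop mul x (mul x x) = 0 := by
  ext z
  have h₁ := flexible_linearized flex x x z
  have h₂ := flexible_linearized flex x x (mul x z)
  have h₃ := congrArg (mul x) h₁
  simp only [map_sub] at h₃
  rw [Dop_apply, flex, sub_self, zero_sub, LinearMap.zero_apply, neg_eq_zero,
    sub_eq_iff_eq_add.mp h₁, sub_eq_iff_eq_add.mp h₂]
  simp only [map_add, map_sub, jordan, flex]
  abel

theorem Dop_sq_linearized (hchar : (2 : F) ≠ 0)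
    (flex : ∀ x y : A, mul (mul x y) x = mul x (mul y x))
    (jordan : ∀ x y : A, mul (mul x y) (mul x x) = mul x (mul y (mul x x))) (x y : A) :
    Dop mul y (mul x y + mul y x) + Dop mul x (mul y y) = 0 := by
  have h₁ := Dop_self_sq flex jordan (x + y)
  have h₂ := Dop_self_sq flex jordan (x - y)
  have h₃ := Dop_self_sq flex jordan x
  simp only [map_add, map_sub, LinearMap.add_apply, LinearMap.sub_apply, Dop_add_left,
    Dop_add_right, Dop_sub_left, Dop_sub_right, h₃] at h₁ h₂ ⊢
  refine (smul_eq_zero_iff_right hchar).mp ?_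
  rw [two_smul]
  linear_combination (norm := abel) h₁ + h₂

theorem Dop_cyclic_symm (hchar : (2 : F) ≠ 0)
    (flex : ∀ x y : A, mul (mul x y) x = mul x (mul y x))
    (jordan : ∀ x y : A, mul (mul x y) (mul x x) = mul x (mul y (mul x x))) (a b c : A) :
    Dop mul (mul a b + mul b a) c + Dop mul (mul b c + mul c b) a
      + Dop mul (mul c a + mul a c) b = 0 := by
  have h := Dop_sq_linearized hchar flex jordan a (b + c)
  have hb := Dop_sq_linearized hchar flex jordan a b
  have hc := Dop_sq_linearized hchar flex jordan a c
  rw [Dop_swap _ c, Dop_swap _ a, Dop_swap _ b]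
  simp only [map_add, LinearMap.add_apply, Dop_add_right, Dop_add_left] at h hb hc ⊢
  linear_combination (norm := abel) hb + hc - h

theorem Dop_cyclic_skew
    (hder : ∀ x y a b : A,
      Dop mul x y (mul a b) = mul (Dop mul x y a) b + mul a (Dop mul x y b)) (a b c : A) :
    Dop mul (mul a b - mul b a) c + Dop mul (mul b c - mul c b) a
      + Dop mul (mul c a - mul a c) b = 0 := by
  have key : ∀ t, mul (Dop mul a b c + Dop mul b c a + Dop mul c a b) t
      = Dop mul a b (mul c t) - mul c (Dop mul a b t) + (Dop mul b c (mul a t)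
        - mul a (Dop mul b c t)) + (Dop mul c a (mul b t) - mul b (Dop mul c a t)) := by
    intro t
    simp only [hder, map_add, LinearMap.add_apply]
    abel
  have hsum : Dop mul a b c + Dop mul b c a + Dop mul c a b
      = mul (mul a b - mul b a) c - mul c (mul a b - mul b a)
        + (mul (mul b c - mul c b) a - mul a (mul b c - mul c b))
        + (mul (mul c a - mul a c) b - mul b (mul c a - mul a c)) := by
    simp only [Dop_apply, map_sub, LinearMap.sub_apply]
    abel
  ext t
  have h := key t
  rw [hsum] at h
  simp only [Dop_apply, map_add, map_sub, LinearMap.add_apply, LinearMap.sub_apply,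
    LinearMap.zero_apply] at h ⊢
  linear_combination (norm := abel) h

theorem Dop_cyclic (hchar : (2 : F) ≠ 0)
    (flex : ∀ x y : A, mul (mul x y) x = mul x (mul y x))
    (jordan : ∀ x y : A, mul (mul x y) (mul x x) = mul x (mul y (mul x x)))
    (hder : ∀ x y a b : A,
      Dop mul x y (mul a b) = mul (Dop mul x y a) b + mul a (Dop mul x y b)) (a b c : A) :
    Dop mul (mul a b) c + Dop mul (mul b c) a + Dop mul (mul c a) b = 0 := by
  refine (smul_eq_zero_iff_right hchar).mp ?_
  have h₁ := Dop_cyclic_symm hchar flex jordan a b c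
  have h₂ := Dop_cyclic_skew hder a b c
  simp only [Dop_add_left, Dop_sub_left] at h₁ h₂
  rw [two_smul]
  linear_combination (norm := abel) h₁ + h₂

theorem trip_eq (inv : A →ₗ[F] A) (x y z : A) :
    trip mul inv x y z = mul (mul x (inv y)) z - Dop mul x (inv y) z := by
  rw [trip, Dop_apply]
  abel

/-- The involution carries left to right multiplications, and flexibility turns the
resulting operator back into `Dop`. -/
theorem inv_trip (flex : ∀ x y : A, mul (mul x y) x = mul x (mul y x)) {inv : A →ₗ[F] A}
    (hinv : ∀ x : A, inv (inv x) = x)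
    (hinvmul : ∀ x y : A, inv (mul x y) = mul (inv y) (inv x)) (u v y : A) :
    inv (trip mul inv v u y) = mul (inv y) (mul u (inv v)) + Dop mul u (inv v) (inv y) := by
  have h₁ := flexible_linearized flex u (inv v) (inv y)
  have h₂ := flexible_linearized flex (inv v) u (inv y)
  simp only [trip, Dop_apply, map_add, map_sub, hinv, hinvmul]
  linear_combination (norm := abel) h₂ - h₁

/-- The operators `L_{xs} - D_{x,s}` transform under left multiplication by `p`. -/
theorem mul_sub_Dop (hchar : (2 : F) ≠ 0)
    (flex : ∀ x y : A, mul (mul x y) x = mul x (mul y x))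
    (jordan : ∀ x y : A, mul (mul x y) (mul x x) = mul x (mul y (mul x x)))
    (hder : ∀ x y a b : A,
      Dop mul x y (mul a b) = mul (Dop mul x y a) b + mul a (Dop mul x y b)) (p x s z : A) :
    mul p (mul (mul x s) z - Dop mul x s z) =
      mul (mul (mul p x) s) z - Dop mul (mul p x) s z
        - (mul (mul x (mul s p)) z - Dop mul x (mul s p) z)
        + (mul (mul x s) (mul p z) - Dop mul x s (mul p z)) := by
  have hc : Dop mul (mul p x) s z = Dop mul p (mul x s) z + Dop mul x (mul s p) z := by
    have h := Dop_cyclic hchar flex jordan hder p x s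
    rw [Dop_swap _ p, Dop_swap _ x] at h
    have h' := LinearMap.congr_fun h z
    simp only [LinearMap.add_apply, LinearMap.neg_apply, LinearMap.zero_apply] at h'
    linear_combination (norm := abel) h'
  have hf := congrArg (fun a => mul a z) (flexible_linearized flex p x s)
  simp only [map_sub, LinearMap.sub_apply] at hf
  have hd := hder x s p z
  rw [Dop_apply x s p] at hd
  simp only [map_sub, LinearMap.sub_apply] at hd
  rw [hc, Dop_apply p, map_sub]
  linear_combination (norm := abel) hd - hf

end Dop

/-- Let `(A,·)` be a unital algebra in the variety `𝒱` (noncommutative Jordan with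
all `D_{x,y}` derivations) over a field of characteristic `≠ 2`, with an
involution `x ↦ x̄`.  Then the triple product `xyz := x·(ȳ·z) − ȳ·(x·z) + (ȳ·x)·z`
makes `A` a generalized Jordan triple system, and with `e = 1`: `eee = e`,
`eex = x = xee` and `exe = x̄` for all `x`. -/
theorem stmt8 {F A : Type*} [Field F] [AddCommGroup A] [Module F A]
    (hchar : (2 : F) ≠ 0)
    (mul : A →ₗ[F] A →ₗ[F] A) (one : A)
    (honel : ∀ x : A, mul one x = x) (honer : ∀ x : A, mul x one = x)
    (flex : ∀ x y : A, mul (mul x y) x = mul x (mul y x))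
    (jordan : ∀ x y : A, mul (mul x y) (mul x x) = mul x (mul y (mul x x)))
    (hder : ∀ x y a b : A,
      Dop mul x y (mul a b) = mul (Dop mul x y a) b + mul a (Dop mul x y b))
    (inv : A →ₗ[F] A)
    (hinv : ∀ x : A, inv (inv x) = x)
    (hinvmul : ∀ x y : A, inv (mul x y) = mul (inv y) (inv x)) :
    (∀ u v x y z : A,
      trip mul inv u v (trip mul inv x y z) =
        trip mul inv (trip mul inv u v x) y z -
          trip mul inv x (trip mul inv v u y) z +
          trip mul inv x y (trip mul inv u v z)) ∧
    trip mul inv one one one = one ∧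
    (∀ x : A, trip mul inv one one x = x ∧ trip mul inv x one one = x) ∧
    (∀ x : A, trip mul inv one x one = inv x) := by
  have hone : inv one = one := by
    rw [← honel (inv one), ← hinv (mul one (inv one)), hinvmul, hinv, honel, hinv]
  refine ⟨fun u v x y z => ?_, ?_, fun x => ⟨?_, ?_⟩, fun x => ?_⟩
  · have hE := derivation_Dop (hder u (inv v)) x (inv y) z
    have hp := mul_sub_Dop hchar flex jordan hder (mul u (inv v)) x (inv y) z
    rw [trip_eq inv u v, trip_eq inv x (trip mul inv v u y), inv_trip flex hinv hinvmul]
    simp only [trip_eq]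
    rw [hp]
    simp only [map_add, map_sub, LinearMap.add_apply, LinearMap.sub_apply, Dop_add_right,
      Dop_sub_left, hE, hder u (inv v)]
    abel
  · simp [trip, hone, honel]
  · simp [trip, hone, honel]
  · simp [trip, hone, honel, honer]
  · simp [trip, honel, honer]
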